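/- There is no order isomorphism between the linear order ℚ ⊕ₗ ℝ (the lexicographic sum in which every rational number precedes every real number, each summand carrying its usual order) and its order dual (ℚ ⊕ₗ ℝ)ᵒᵈ. -/

import Mathlib

open Sum

theorem countable_Iio_inlₗ {α β : Type*} [Preorder α] [Preorder β] [Countable α] (a : α) :
    (Set.Iio (Sum.inlₗ a : α ⊕ₗ β)).Countable := by
  refine (Set.countable_range (Sum.inlₗ : α → α ⊕ₗ β)).mono fun x hx => ?_
  rcases x with b | b
  · exact ⟨b, rfl⟩
  · exact absurd hx Sum.Lex.not_inr_lt_inl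

theorem not_countable_Ioi_lex_real {α : Type*} [Preorder α] (x : α ⊕ₗ ℝ) :
    ¬ (Set.Ioi x).Countable := by
  obtain ⟨r, hr⟩ : ∃ r : ℝ, ∀ s, r < s → x < Sum.inrₗ s := by
    rcases x with a | t
    · exact ⟨0, fun s _ => Sum.Lex.inl_lt_inr a s⟩
    · exact ⟨t, fun s hs => Sum.Lex.inr_lt_inr_iff.2 hs⟩
  intro hx
  have hinj : Function.Injective (Sum.inrₗ : ℝ → α ⊕ₗ ℝ) :=
    toLex.injective.comp Sum.inr_injective
  have hr' : (Set.Ioi r).Countable := (hx.preimage hinj).mono hr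
  have := Cardinal.le_aleph0_iff_set_countable.2 hr'
  rw [Cardinal.mk_Ioi_real] at this
  exact Cardinal.aleph0_lt_continuum.not_ge this

/-- There is no order isomorphism between the linear order `ℚ ⊕ₗ ℝ`
(the lexicographic sum in which every rational precedes every real, each summand carrying
its usual order) and its order dual `(ℚ ⊕ₗ ℝ)ᵒᵈ`. -/
theorem no_orderIso_ratSumReal_orderDual :
    IsEmpty ((ℚ ⊕ₗ ℝ) ≃o (ℚ ⊕ₗ ℝ)ᵒᵈ) := by
  refine ⟨fun f => ?_⟩
  have h : (f '' Set.Iio (Sum.inlₗ 0)).Countable := (countable_Iio_inlₗ 0).image f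
  rw [f.image_Iio] at h
  exact not_countable_Ioi_lex_real (OrderDual.ofDual (f (Sum.inlₗ 0))) h
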